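/- arXiv:1807.11664 — 2 statements merged into one kernel-verified Lean document; each statement's English description precedes it below -/
import Mathlib

section
/- The group B_3(ℂ) (the realization of Spin(7,ℂ)) acts transitively on the complex unit sphere S_ℂ^7 = {v ∈ ℂ^8 : (v,v) = 1}: for every v ∈ ℂ^8 with (v,v) = 1 there exists g ∈ B_3(ℂ) with g e_0 = v. Hence S_ℂ^7 is identified with the non-symmetric homogeneous space Spin(7,ℂ)/G_2(ℂ). -/
open Matrix

noncomputable section

/-- The standard basis of the complexified Cayley algebra `𝕆_ℂ = ℂ^8`. -/
def e (i : Fin 8) : Fin 8 → ℂ := Pi.single i 1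

/-- The oriented lines of the multiplication table of the Cayley algebra:
`(i, j, k)` in this list means `e_i e_j = e_k`. -/
def octLines : List (Fin 8 × Fin 8 × Fin 8) :=
  [(1,2,3),(2,3,1),(3,1,2),
   (1,4,5),(4,5,1),(5,1,4),
   (1,6,7),(6,7,1),(7,1,6),
   (2,5,7),(5,7,2),(7,2,5),
   (2,6,4),(6,4,2),(4,2,6),
   (3,5,6),(5,6,3),(6,3,5),
   (3,4,7),(4,7,3),(7,3,4)]

/-- Product of two basis elements of the complexified Cayley algebra. -/
def octBasisMul (i j : Fin 8) : Fin 8 → ℂ :=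
  if i = 0 then e j
  else if j = 0 then e i
  else if i = j then -(e 0)
  else
    match octLines.find? (fun t => t.1 == i && t.2.1 == j) with
    | some t => e t.2.2
    | none =>
      match octLines.find? (fun t => t.1 == j && t.2.1 == i) with
      | some t => -(e t.2.2)
      | none => 0

/-- The bilinear multiplication of the complexified Cayley algebra `𝕆_ℂ`. -/
def octMul (x y : Fin 8 → ℂ) : Fin 8 → ℂ :=
  ∑ i, ∑ j, (x i * y j) • octBasisMul i j

/-- The standard symmetric bilinear form on `ℂ^8`. -/
def bform (v w : Fin 8 → ℂ) : ℂ := ∑ i, v i * w i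

/-- `SO(8, ℂ)`. -/
def SO8 (g : Matrix (Fin 8) (Fin 8) ℂ) : Prop := gᵀ * g = 1 ∧ g.det = 1

/-- A matrix has real entries. -/
def realMat (g : Matrix (Fin 8) (Fin 8) ℂ) : Prop := ∀ i j, (g i j).im = 0

/-- The realization of `G₂(ℂ)` as automorphisms of `𝕆_ℂ`. -/
def inG2 (g : Matrix (Fin 8) (Fin 8) ℂ) : Prop :=
  SO8 g ∧ ∀ x y, g.mulVec (octMul x y) = octMul (g.mulVec x) (g.mulVec y)

/-- The compact real form `G₂`. -/
def inG2cpt (g : Matrix (Fin 8) (Fin 8) ℂ) : Prop := inG2 g ∧ realMat g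

/-- The realization `B₃(ℂ)` of `Spin(7, ℂ)`. -/
def inB3 (g : Matrix (Fin 8) (Fin 8) ℂ) : Prop :=
  SO8 g ∧ ∃ g₀, SO8 g₀ ∧ g₀.mulVec (e 0) = e 0 ∧
    ∀ x y, octMul (g₀.mulVec x) (g.mulVec y) = g.mulVec (octMul x y)

/-- The compact real form `Spin(7)`. -/
def inSpin7 (g : Matrix (Fin 8) (Fin 8) ℂ) : Prop :=
  SO8 g ∧ realMat g ∧ ∃ g₀, SO8 g₀ ∧ realMat g₀ ∧ g₀.mulVec (e 0) = e 0 ∧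
    ∀ x y, octMul (g₀.mulVec x) (g.mulVec y) = g.mulVec (octMul x y)

/-- The one-parameter group `t_θ` (abelian slice `A₁` for `(G₂(ℂ), SL(3,ℂ))`). -/
def tmat (θ : ℝ) : Matrix (Fin 8) (Fin 8) ℂ :=
  Matrix.of fun i j =>
    (![ e 0,
        (Real.cosh θ : ℂ) • e 1 + (Complex.I * (Real.sinh θ : ℂ)) • e 2,
        (-(Complex.I * (Real.sinh θ : ℂ))) • e 1 + (Real.cosh θ : ℂ) • e 2,
        e 3,
        (Real.cosh (θ/2) : ℂ) • e 4 + (-(Complex.I * (Real.sinh (θ/2) : ℂ))) • e 7,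
        (Real.cosh (θ/2) : ℂ) • e 5 + (-(Complex.I * (Real.sinh (θ/2) : ℂ))) • e 6,
        (Complex.I * (Real.sinh (θ/2) : ℂ)) • e 5 + (Real.cosh (θ/2) : ℂ) • e 6,
        (Complex.I * (Real.sinh (θ/2) : ℂ)) • e 4 + (Real.cosh (θ/2) : ℂ) • e 7 ] j) i

/-- The generator `τ₁` of the one-parameter group `A₁`, i.e. `exp (θ τ₁) = t_θ`. -/
def tau1 : Matrix (Fin 8) (Fin 8) ℂ :=
  Matrix.of fun i j =>
    (![ 0,
        Complex.I • e 2,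
        (-Complex.I) • e 1,
        0,
        (-(Complex.I/2)) • e 7,
        (-(Complex.I/2)) • e 6,
        (Complex.I/2) • e 5,
        (Complex.I/2) • e 4 ] j) i

/-- The one-parameter group `ã_θ` (abelian slice `Ã₀` for `(Spin(7,ℂ), G₂(ℂ))`). -/
def atil (θ : ℝ) : Matrix (Fin 8) (Fin 8) ℂ :=
  Matrix.of fun i j =>
    (![ (Real.cosh θ : ℂ) • e 0 + (Complex.I * (Real.sinh θ : ℂ)) • e 1,
        (-(Complex.I * (Real.sinh θ : ℂ))) • e 0 + (Real.cosh θ : ℂ) • e 1,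
        (Real.cosh (θ/3) : ℂ) • e 2 + (-(Complex.I * (Real.sinh (θ/3) : ℂ))) • e 3,
        (Complex.I * (Real.sinh (θ/3) : ℂ)) • e 2 + (Real.cosh (θ/3) : ℂ) • e 3,
        (Real.cosh (θ/3) : ℂ) • e 4 + (-(Complex.I * (Real.sinh (θ/3) : ℂ))) • e 5,
        (Complex.I * (Real.sinh (θ/3) : ℂ)) • e 4 + (Real.cosh (θ/3) : ℂ) • e 5,
        (Real.cosh (θ/3) : ℂ) • e 6 + (-(Complex.I * (Real.sinh (θ/3) : ℂ))) • e 7,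
        (Complex.I * (Real.sinh (θ/3) : ℂ)) • e 6 + (Real.cosh (θ/3) : ℂ) • e 7 ] j) i

/-- The generator `α̃₁` of the one-parameter group `Ã₀`, i.e. `exp (θ α̃₁) = ã_θ`. -/
def alphatil1 : Matrix (Fin 8) (Fin 8) ℂ :=
  Matrix.of fun i j =>
    (![ Complex.I • e 1,
        (-Complex.I) • e 0,
        (-(Complex.I/3)) • e 3,
        (Complex.I/3) • e 2,
        (-(Complex.I/3)) • e 5,
        (Complex.I/3) • e 4,
        (-(Complex.I/3)) • e 7,
        (Complex.I/3) • e 6 ] j) i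

/-- The one-parameter group `a_x` (abelian slice `A₀` for `(SO(7,ℂ), G₂(ℂ))`). -/
def amat (x : ℝ) : Matrix (Fin 8) (Fin 8) ℂ :=
  Matrix.of fun i j =>
    (![ e 0,
        e 1,
        (Real.cosh x : ℂ) • e 2 + (Complex.I * (Real.sinh x : ℂ)) • e 3,
        (-(Complex.I * (Real.sinh x : ℂ))) • e 2 + (Real.cosh x : ℂ) • e 3,
        (Real.cosh x : ℂ) • e 4 + (Complex.I * (Real.sinh x : ℂ)) • e 5,
        (-(Complex.I * (Real.sinh x : ℂ))) • e 4 + (Real.cosh x : ℂ) • e 5,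
        (Real.cosh x : ℂ) • e 6 + (Complex.I * (Real.sinh x : ℂ)) • e 7,
        (-(Complex.I * (Real.sinh x : ℂ))) • e 6 + (Real.cosh x : ℂ) • e 7 ] j) i

/-- The matrix `I₊₋ = diag(1, −1, 1, −1, 1, −1, 1, −1)`. -/
def Ipm : Matrix (Fin 8) (Fin 8) ℂ :=
  Matrix.diagonal ![1, -1, 1, -1, 1, -1, 1, -1]

/-- The anti-holomorphic involution `σ₀(g) = I₊₋ ḡ I₊₋`. -/
def sigma0 (g : Matrix (Fin 8) (Fin 8) ℂ) : Matrix (Fin 8) (Fin 8) ℂ :=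
  Ipm * g.map (starRingEnd ℂ) * Ipm

end

@[simp]
theorem octMul_apply_zero (x y : Fin 8 → ℂ) : octMul x y 0 =
    x 0 * y 0 - x 1 * y 1 - x 2 * y 2 - x 3 * y 3 - x 4 * y 4 - x 5 * y 5 - x 6 * y 6 - x 7 * y 7 := by
  simp [octMul, octBasisMul, octLines, e, Fin.sum_univ_eight]
  ring

@[simp]
theorem octMul_apply_one (x y : Fin 8 → ℂ) : octMul x y 1 =
    x 0 * y 1 + x 1 * y 0 + x 2 * y 3 - x 3 * y 2 + x 4 * y 5 - x 5 * y 4 + x 6 * y 7 - x 7 * y 6 := by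
  simp [octMul, octBasisMul, octLines, e, Fin.sum_univ_eight]
  ring

@[simp]
theorem octMul_apply_two (x y : Fin 8 → ℂ) : octMul x y 2 =
    x 0 * y 2 + x 2 * y 0 + x 3 * y 1 - x 1 * y 3 + x 5 * y 7 - x 7 * y 5 + x 6 * y 4 - x 4 * y 6 := by
  simp [octMul, octBasisMul, octLines, e, Fin.sum_univ_eight]
  ring

@[simp]
theorem octMul_apply_three (x y : Fin 8 → ℂ) : octMul x y 3 =
    x 0 * y 3 + x 3 * y 0 + x 1 * y 2 - x 2 * y 1 + x 5 * y 6 - x 6 * y 5 + x 4 * y 7 - x 7 * y 4 := by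
  simp [octMul, octBasisMul, octLines, e, Fin.sum_univ_eight]
  ring

@[simp]
theorem octMul_apply_four (x y : Fin 8 → ℂ) : octMul x y 4 =
    x 0 * y 4 + x 4 * y 0 + x 5 * y 1 - x 1 * y 5 + x 2 * y 6 - x 6 * y 2 + x 7 * y 3 - x 3 * y 7 := by
  simp [octMul, octBasisMul, octLines, e, Fin.sum_univ_eight]
  ring

@[simp]
theorem octMul_apply_five (x y : Fin 8 → ℂ) : octMul x y 5 =
    x 0 * y 5 + x 5 * y 0 + x 1 * y 4 - x 4 * y 1 + x 7 * y 2 - x 2 * y 7 + x 6 * y 3 - x 3 * y 6 := by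
  simp [octMul, octBasisMul, octLines, e, Fin.sum_univ_eight]
  ring

@[simp]
theorem octMul_apply_six (x y : Fin 8 → ℂ) : octMul x y 6 =
    x 0 * y 6 + x 6 * y 0 + x 7 * y 1 - x 1 * y 7 + x 4 * y 2 - x 2 * y 4 + x 3 * y 5 - x 5 * y 3 := by
  simp [octMul, octBasisMul, octLines, e, Fin.sum_univ_eight]
  ring

@[simp]
theorem octMul_apply_seven (x y : Fin 8 → ℂ) : octMul x y 7 =
    x 0 * y 7 + x 7 * y 0 + x 1 * y 6 - x 6 * y 1 + x 2 * y 5 - x 5 * y 2 + x 3 * y 4 - x 4 * y 3 := by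
  simp [octMul, octBasisMul, octLines, e, Fin.sum_univ_eight]
  ring

/-- The matrix of left multiplication by `a`. -/
def octLeft (a : Fin 8 → ℂ) : Matrix (Fin 8) (Fin 8) ℂ :=
  Matrix.of fun k j => octMul a (e j) k

/-- The matrix of right multiplication by `a`. -/
def octRight (a : Fin 8 → ℂ) : Matrix (Fin 8) (Fin 8) ℂ :=
  Matrix.of fun k j => octMul (e j) a k

theorem octLeft_mulVec (a x : Fin 8 → ℂ) : (octLeft a).mulVec x = octMul a x := by
  ext k
  fin_cases k <;>
    simp [octLeft, e, Matrix.mulVec, dotProduct, Fin.sum_univ_eight,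
      Pi.single_apply] <;> ring

theorem octRight_mulVec (a x : Fin 8 → ℂ) : (octRight a).mulVec x = octMul x a := by
  ext k
  fin_cases k <;>
    simp [octRight, e, Matrix.mulVec, dotProduct, Fin.sum_univ_eight,
      Pi.single_apply] <;> ring

theorem octLeft_transpose {a : Fin 8 → ℂ} (ha : a 0 = 0) : (octLeft a)ᵀ = -octLeft a := by
  ext i j
  fin_cases i <;> fin_cases j <;> simp [octLeft, e, ha]

theorem octRight_transpose {a : Fin 8 → ℂ} (ha : a 0 = 0) : (octRight a)ᵀ = -octRight a := by
  ext i j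
  fin_cases i <;> fin_cases j <;> simp [octRight, e, ha]

theorem octMul_octMul_self_left {a : Fin 8 → ℂ} (ha : a 0 = 0) (x : Fin 8 → ℂ) :
    octMul a (octMul a x) = -(bform a a • x) := by
  ext k
  fin_cases k <;> simp [bform, Fin.sum_univ_eight, ha] <;> ring

theorem octMul_octMul_self_right {a : Fin 8 → ℂ} (ha : a 0 = 0) (x : Fin 8 → ℂ) :
    octMul (octMul x a) a = -(bform a a • x) := by
  ext k
  fin_cases k <;> simp [bform, Fin.sum_univ_eight, ha] <;> ring

theorem bform_octMul (x y : Fin 8 → ℂ) :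
    bform (octMul x y) (octMul x y) = bform x x * bform y y := by
  simp [bform, Fin.sum_univ_eight]
  ring

theorem octMul_e_zero (x : Fin 8 → ℂ) : octMul x (e 0) = x := by
  ext k
  fin_cases k <;> simp [e]

theorem octMul_e_zero_left (x : Fin 8 → ℂ) : octMul (e 0) x = x := by
  ext k
  fin_cases k <;> simp [e]

theorem octMul_neg_left (x y : Fin 8 → ℂ) : octMul (-x) y = -octMul x y := by
  simp [octMul, Finset.sum_neg_distrib]

/-- A form of the left Moufang identity, `(a x a) (a y) = a (x (a (a y)))`, for imaginary `a`. -/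
theorem octMul_moufang {a : Fin 8 → ℂ} (ha : a 0 = 0) (x y : Fin 8 → ℂ) :
    octMul (octMul a (octMul x a)) (octMul a y) = -(bform a a • octMul a (octMul x y)) := by
  ext k
  fin_cases k <;> simp [bform, Fin.sum_univ_eight, ha] <;> ring

theorem SO8.mul {g h : Matrix (Fin 8) (Fin 8) ℂ} (hg : SO8 g) (hh : SO8 h) : SO8 (g * h) := by
  refine ⟨?_, by rw [Matrix.det_mul, hg.2, hh.2, one_mul]⟩
  rw [Matrix.transpose_mul, Matrix.mul_assoc, ← Matrix.mul_assoc gᵀ, hg.1, Matrix.one_mul, hh.1]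

theorem SO8.neg {g : Matrix (Fin 8) (Fin 8) ℂ} (hg : SO8 g) : SO8 (-g) := by
  refine ⟨by simp [hg.1], ?_⟩
  rw [Matrix.det_neg, hg.2]
  norm_num

/-- A skew-symmetric matrix squaring to `-1` has determinant one, because
`(1 + J)² = 2 J` and `(1 + J) (1 + J)ᵀ = 2`. -/
theorem SO8_of_skew {J : Matrix (Fin 8) (Fin 8) ℂ} (hT : Jᵀ = -J) (hJ : J * J = -1) :
    SO8 J := by
  refine ⟨by rw [hT, Matrix.neg_mul, hJ, neg_neg], ?_⟩
  have h₁ : (1 + J) * (1 + J) = (2 : ℂ) • J := by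
    rw [mul_add, add_mul, add_mul, hJ, two_smul, mul_one, mul_one, one_mul]
    abel
  have h₂ : (1 + J) * (1 + J)ᵀ = (2 : ℂ) • (1 : Matrix (Fin 8) (Fin 8) ℂ) := by
    rw [Matrix.transpose_add, hT, Matrix.transpose_one, mul_add, add_mul, add_mul, mul_neg,
      mul_neg, hJ, two_smul]
    simp
  have d₁ := congrArg Matrix.det h₁
  have d₂ := congrArg Matrix.det h₂
  rw [Matrix.det_mul, Matrix.det_smul] at d₁ d₂
  rw [Matrix.det_transpose, Matrix.det_one, d₁] at d₂
  exact mul_left_cancel₀ (by simp) d₂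

theorem SO8_octLeft {a : Fin 8 → ℂ} (ha : a 0 = 0) (hn : bform a a = 1) : SO8 (octLeft a) := by
  refine SO8_of_skew (octLeft_transpose ha) (Matrix.ext_of_mulVec_single fun i => ?_)
  rw [← Matrix.mulVec_mulVec, octLeft_mulVec, octLeft_mulVec, octMul_octMul_self_left ha, hn,
    one_smul, Matrix.neg_mulVec, Matrix.one_mulVec]

theorem SO8_octRight {a : Fin 8 → ℂ} (ha : a 0 = 0) (hn : bform a a = 1) : SO8 (octRight a) := by
  refine SO8_of_skew (octRight_transpose ha) (Matrix.ext_of_mulVec_single fun i => ?_)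
  rw [← Matrix.mulVec_mulVec, octRight_mulVec, octRight_mulVec, octMul_octMul_self_right ha, hn,
    one_smul, Matrix.neg_mulVec, Matrix.one_mulVec]

/-- Left multiplication by an imaginary unit lies in `B₃(ℂ)`. -/
theorem inB3_octLeft {a : Fin 8 → ℂ} (ha : a 0 = 0) (hn : bform a a = 1) : inB3 (octLeft a) := by
  have key (x : Fin 8 → ℂ) :
      (-(octLeft a * octRight a)).mulVec x = -octMul a (octMul x a) := by
    rw [Matrix.neg_mulVec, ← Matrix.mulVec_mulVec, octLeft_mulVec, octRight_mulVec]
  refine ⟨SO8_octLeft ha hn, -(octLeft a * octRight a),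
    ((SO8_octLeft ha hn).mul (SO8_octRight ha hn)).neg, ?_, fun x y => ?_⟩
  · have h := octMul_octMul_self_left ha (e 0)
    rw [octMul_e_zero, hn, one_smul] at h
    rw [key, octMul_e_zero_left, h, neg_neg]
  · rw [key, octLeft_mulVec, octLeft_mulVec, octMul_neg_left, octMul_moufang ha, hn, one_smul,
      neg_neg]

theorem inB3.mul {g h : Matrix (Fin 8) (Fin 8) ℂ} (hg : inB3 g) (hh : inB3 h) :
    inB3 (g * h) := by
  obtain ⟨hg, g₀, hg₀, hge, hgm⟩ := hg
  obtain ⟨hh, h₀, hh₀, hhe, hhm⟩ := hh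
  refine ⟨hg.mul hh, g₀ * h₀, hg₀.mul hh₀, ?_, fun x y => ?_⟩
  · rw [← Matrix.mulVec_mulVec, hhe, hge]
  · simp only [← Matrix.mulVec_mulVec]
    rw [hgm, hhm]

/-- A linear functional on the imaginary octonions is annihilated by an imaginary unit. -/
theorem exists_imaginary_unit_orthogonal (v : Fin 8 → ℂ) :
    ∃ a : Fin 8 → ℂ, a 0 = 0 ∧ bform a a = 1 ∧ bform a v = 0 := by
  have unit_of_pair (p q : ℂ) (h : p ^ 2 + q ^ 2 ≠ 0) :
      ∃ s : ℂ, (s * p) * (s * p) + (s * q) * (s * q) = 1 := by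
    obtain ⟨t, ht⟩ := IsAlgClosed.exists_pow_nat_eq (p ^ 2 + q ^ 2)⁻¹ (n := 2) (by norm_num)
    refine ⟨t, ?_⟩
    calc (t * p) * (t * p) + (t * q) * (t * q) = t ^ 2 * (p ^ 2 + q ^ 2) := by ring
      _ = 1 := by rw [ht, inv_mul_cancel₀ h]
  by_cases h₁₂ : v 1 ^ 2 + v 2 ^ 2 = 0
  · by_cases h₁₃ : v 1 ^ 2 + v 3 ^ 2 = 0
    · by_cases h₂₃ : v 2 ^ 2 + v 3 ^ 2 = 0
      · have hv : v 1 = 0 := by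
          have : v 1 ^ 2 = 0 := by linear_combination (h₁₂ + h₁₃ - h₂₃) / 2
          simpa using this
        exact ⟨e 1, by simp [e], by simp [bform, e, Pi.single_apply],
          by simp [bform, e, Pi.single_apply, hv]⟩
      · obtain ⟨s, hs⟩ := unit_of_pair _ _ h₂₃
        refine ⟨![0, 0, -(s * v 3), s * v 2, 0, 0, 0, 0], rfl, ?_, ?_⟩
        · simp [bform, Fin.sum_univ_eight]
          linear_combination hs
        · simp [bform, Fin.sum_univ_eight]
          ring
    · obtain ⟨s, hs⟩ := unit_of_pair _ _ h₁₃
      refine ⟨![0, -(s * v 3), 0, s * v 1, 0, 0, 0, 0], rfl, ?_, ?_⟩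
      · simp [bform, Fin.sum_univ_eight]
        linear_combination hs
      · simp [bform, Fin.sum_univ_eight]
        ring
  · obtain ⟨s, hs⟩ := unit_of_pair _ _ h₁₂
    refine ⟨![0, -(s * v 2), s * v 1, 0, 0, 0, 0, 0], rfl, ?_, ?_⟩
    · simp [bform, Fin.sum_univ_eight]
      linear_combination hs
    · simp [bform, Fin.sum_univ_eight]
      ring

/-- Every point of the complex unit sphere is a product of two imaginary units. -/
theorem exists_imaginary_units_octMul (v : Fin 8 → ℂ) (hv : bform v v = 1) :
    ∃ a b : Fin 8 → ℂ, (a 0 = 0 ∧ bform a a = 1) ∧ (b 0 = 0 ∧ bform b b = 1) ∧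
      octMul a b = v := by
  obtain ⟨a, ha, hn, hav⟩ := exists_imaginary_unit_orthogonal v
  have hn' : bform (-a) (-a) = 1 := by simpa [bform] using hn
  refine ⟨a, octMul (-a) v, ⟨ha, hn⟩, ⟨?_, ?_⟩, ?_⟩
  · simp only [bform, Fin.sum_univ_eight, ha] at hav
    simp [ha]
    linear_combination hav
  · rw [bform_octMul, hn', hv, one_mul]
  · have h := octMul_octMul_self_left (a := -a) (by simp [ha]) v
    rw [hn', one_smul, octMul_neg_left, neg_inj] at h
    exact h

/-- The group `B₃(ℂ)` (the realization of `Spin(7,ℂ)`) acts transitively on the complex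
unit sphere `S_ℂ^7 = {v ∈ ℂ^8 : (v, v) = 1}`: every such `v` is of the form `g e₀` for
some `g ∈ B₃(ℂ)`.  Hence `S_ℂ^7` is identified with the non-symmetric homogeneous space
`Spin(7,ℂ)/G₂(ℂ)`. -/
theorem stmt4 (v : Fin 8 → ℂ) (hv : bform v v = 1) :
    ∃ g : Matrix (Fin 8) (Fin 8) ℂ, inB3 g ∧ g.mulVec (e 0) = v := by
  obtain ⟨a, b, ⟨ha, hna⟩, ⟨hb, hnb⟩, hab⟩ := exists_imaginary_units_octMul v hv
  refine ⟨octLeft a * octLeft b, (inB3_octLeft ha hna).mul (inB3_octLeft hb hnb), ?_⟩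
  rw [← Matrix.mulVec_mulVec, octLeft_mulVec, octLeft_mulVec, octMul_e_zero, hab]
end

section
/- For every θ ∈ ℝ, the matrices ã_θ and a_{2θ/3} belong to SO(8,ℂ), a_{2θ/3} e_0 = e_0, and (a_{2θ/3} x)(ã_θ y) = ã_θ(x y) for all x, y ∈ 𝕆_ℂ. In particular ã_θ ∈ B_3(ℂ), so the abelian group Ã_0 = {ã_θ : θ ∈ ℝ} is contained in Spin(7,ℂ), and the triality homomorphism π satisfies π(ã_θ) = a_{2θ/3}. -/
open Matrix

open Complex in
/-- The rotation of `ℂ^8` by the complex angle `a` in the plane `(e₀, e₁)` and by the complex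
angle `b` in each of the planes `(e₂, e₃)`, `(e₄, e₅)`, `(e₆, e₇)`. -/
noncomputable def planeRot (a b : ℂ) : Matrix (Fin 8) (Fin 8) ℂ :=
  !![cos a, -sin a, 0, 0, 0, 0, 0, 0;
     sin a, cos a, 0, 0, 0, 0, 0, 0;
     0, 0, cos b, -sin b, 0, 0, 0, 0;
     0, 0, sin b, cos b, 0, 0, 0, 0;
     0, 0, 0, 0, cos b, -sin b, 0, 0;
     0, 0, 0, 0, sin b, cos b, 0, 0;
     0, 0, 0, 0, 0, 0, cos b, -sin b;
     0, 0, 0, 0, 0, 0, sin b, cos b]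

open Complex in
theorem planeRot_mulVec (a b : ℂ) (x : Fin 8 → ℂ) :
    planeRot a b *ᵥ x =
      ![cos a * x 0 - sin a * x 1, sin a * x 0 + cos a * x 1,
        cos b * x 2 - sin b * x 3, sin b * x 2 + cos b * x 3,
        cos b * x 4 - sin b * x 5, sin b * x 4 + cos b * x 5,
        cos b * x 6 - sin b * x 7, sin b * x 6 + cos b * x 7] := by
  ext i
  fin_cases i <;>
    simp [planeRot, mulVec, dotProduct, Fin.sum_univ_eight, sub_eq_add_neg]

theorem planeRot_zero : planeRot 0 0 = 1 := by
  ext i j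
  fin_cases i <;> fin_cases j <;> simp [planeRot]

theorem planeRot_add (a b a' b' : ℂ) :
    planeRot (a + a') (b + b') = planeRot a b * planeRot a' b' := by
  apply Matrix.mulVec_injective
  funext x
  rw [← Matrix.mulVec_mulVec]
  ext i
  fin_cases i <;>
    simp [planeRot_mulVec, Complex.cos_add, Complex.sin_add] <;> ring

theorem planeRot_transpose (a b : ℂ) : (planeRot a b)ᵀ = planeRot (-a) (-b) := by
  ext i j
  fin_cases i <;> fin_cases j <;> simp [planeRot]

theorem planeRot_transpose_mul_self (a b : ℂ) : (planeRot a b)ᵀ * planeRot a b = 1 := by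
  rw [planeRot_transpose, ← planeRot_add, neg_add_cancel, neg_add_cancel, planeRot_zero]

/-- The determinant is `1` because it squares to `1` and every `planeRot` is itself a square. -/
theorem planeRot_det (a b : ℂ) : (planeRot a b).det = 1 := by
  have h := congrArg Matrix.det (planeRot_transpose_mul_self (a / 2) (b / 2))
  rw [Matrix.det_mul, Matrix.det_transpose, Matrix.det_one] at h
  rw [← add_halves a, ← add_halves b, planeRot_add, Matrix.det_mul, h]

theorem planeRot_SO8 (a b : ℂ) : SO8 (planeRot a b) :=
  ⟨planeRot_transpose_mul_self a b, planeRot_det a b⟩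

theorem planeRot_mulVec_e_zero (b : ℂ) : planeRot 0 b *ᵥ e 0 = e 0 := by
  rw [planeRot_mulVec]
  ext i
  fin_cases i <;> simp [e]

theorem octMul_eq (x y : Fin 8 → ℂ) :
    octMul x y = ![
        x 0 * y 0 - x 1 * y 1 - x 2 * y 2 - x 3 * y 3 - x 4 * y 4 - x 5 * y 5 - x 6 * y 6 - x 7 * y 7,
        x 0 * y 1 + x 1 * y 0 + x 2 * y 3 - x 3 * y 2 + x 4 * y 5 - x 5 * y 4 + x 6 * y 7 - x 7 * y 6,
        x 0 * y 2 - x 1 * y 3 + x 2 * y 0 + x 3 * y 1 - x 4 * y 6 + x 5 * y 7 + x 6 * y 4 - x 7 * y 5,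
        x 0 * y 3 + x 1 * y 2 - x 2 * y 1 + x 3 * y 0 + x 4 * y 7 + x 5 * y 6 - x 6 * y 5 - x 7 * y 4,
        x 0 * y 4 - x 1 * y 5 + x 2 * y 6 - x 3 * y 7 + x 4 * y 0 + x 5 * y 1 - x 6 * y 2 + x 7 * y 3,
        x 0 * y 5 + x 1 * y 4 - x 2 * y 7 - x 3 * y 6 - x 4 * y 1 + x 5 * y 0 + x 6 * y 3 + x 7 * y 2,
        x 0 * y 6 - x 1 * y 7 - x 2 * y 4 + x 3 * y 5 + x 4 * y 2 - x 5 * y 3 + x 6 * y 0 + x 7 * y 1,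
        x 0 * y 7 + x 1 * y 6 + x 2 * y 5 + x 3 * y 4 - x 4 * y 3 - x 5 * y 2 - x 6 * y 1 + x 7 * y 0] := by
  simp only [octMul, Fin.sum_univ_eight]
  simp [octBasisMul, octLines]
  ext k
  fin_cases k <;> simp [e] <;> ring

open Complex in
theorem octMul_planeRot (b : ℂ) (x y : Fin 8 → ℂ) :
    octMul (planeRot 0 (2 * b) *ᵥ x) (planeRot (3 * b) (-b) *ᵥ y) =
      planeRot (3 * b) (-b) *ᵥ octMul x y := by
  have hc : cos (3 * b) = cos (2 * b) * cos b - sin (2 * b) * sin b := by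
    rw [← cos_add]; ring_nf
  have hs : sin (3 * b) = sin (2 * b) * cos b + cos (2 * b) * sin b := by
    rw [← sin_add]; ring_nf
  have hc' : cos b = cos (2 * b) * cos b + sin (2 * b) * sin b := by
    rw [← cos_sub]; ring_nf
  have hs' : sin b = sin (2 * b) * cos b - cos (2 * b) * sin b := by
    rw [← sin_sub]; ring_nf
  have kc : cos b = cos (3 * b) * cos (2 * b) + sin (3 * b) * sin (2 * b) := by
    rw [← cos_sub]; ring_nf
  have ks : sin b = sin (3 * b) * cos (2 * b) - cos (3 * b) * sin (2 * b) := by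
    rw [← sin_sub]; ring_nf
  ext k
  fin_cases k <;> simp [planeRot_mulVec, octMul_eq]
  · linear_combination
      (x 2 * y 2 + x 3 * y 3 + x 4 * y 4 + x 5 * y 5 + x 6 * y 6 + x 7 * y 7) * hc +
      (x 2 * y 3 - x 3 * y 2 + x 4 * y 5 - x 5 * y 4 + x 6 * y 7 - x 7 * y 6) * hs
  · linear_combination
      (x 2 * y 2 + x 3 * y 3 + x 4 * y 4 + x 5 * y 5 + x 6 * y 6 + x 7 * y 7) * hs +
      (-x 2 * y 3 + x 3 * y 2 - x 4 * y 5 + x 5 * y 4 - x 6 * y 7 + x 7 * y 6) * hc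
  · linear_combination
      (-x 2 * y 0 - x 3 * y 1) * kc +
      (x 2 * y 1 - x 3 * y 0) * ks +
      (x 4 * y 6 - x 5 * y 7 - x 6 * y 4 + x 7 * y 5) * hc' +
      (-x 4 * y 7 - x 5 * y 6 + x 6 * y 5 + x 7 * y 4) * hs'
  · linear_combination
      (x 2 * y 0 + x 3 * y 1) * ks +
      (x 2 * y 1 - x 3 * y 0) * kc +
      (-x 4 * y 6 + x 5 * y 7 + x 6 * y 4 - x 7 * y 5) * hs' +
      (-x 4 * y 7 - x 5 * y 6 + x 6 * y 5 + x 7 * y 4) * hc'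
  · linear_combination
      (-x 4 * y 0 - x 5 * y 1) * kc +
      (x 4 * y 1 - x 5 * y 0) * ks +
      (-x 2 * y 6 + x 3 * y 7 + x 6 * y 2 - x 7 * y 3) * hc' +
      (x 2 * y 7 + x 3 * y 6 - x 6 * y 3 - x 7 * y 2) * hs'
  · linear_combination
      (x 4 * y 0 + x 5 * y 1) * ks +
      (x 4 * y 1 - x 5 * y 0) * kc +
      (-x 6 * y 2 + x 7 * y 3 + x 2 * y 6 - x 3 * y 7) * hs' +
      (-x 6 * y 3 - x 7 * y 2 + x 2 * y 7 + x 3 * y 6) * hc'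
  · linear_combination
      (-x 6 * y 0 - x 7 * y 1) * kc +
      (x 6 * y 1 - x 7 * y 0) * ks +
      (-x 4 * y 2 + x 5 * y 3 + x 2 * y 4 - x 3 * y 5) * hc' +
      (x 4 * y 3 + x 5 * y 2 - x 2 * y 5 - x 3 * y 4) * hs'
  · linear_combination
      (x 6 * y 0 + x 7 * y 1) * ks +
      (x 6 * y 1 - x 7 * y 0) * kc +
      (-x 2 * y 4 + x 3 * y 5 + x 4 * y 2 - x 5 * y 3) * hs' +
      (-x 2 * y 5 - x 3 * y 4 + x 4 * y 3 + x 5 * y 2) * hc'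

theorem atil_eq_planeRot (θ : ℝ) :
    atil θ = planeRot (3 * (θ / 3 * Complex.I)) (-(θ / 3 * Complex.I)) := by
  have h : 3 * ((θ : ℂ) / 3 * Complex.I) = θ * Complex.I := by ring
  rw [h]
  ext i j
  fin_cases i <;> fin_cases j <;>
    simp [atil, planeRot, e, Complex.cos_mul_I, Complex.sin_mul_I] <;> ring

theorem amat_eq_planeRot (x : ℝ) : amat x = planeRot 0 (x * Complex.I) := by
  ext i j
  fin_cases i <;> fin_cases j <;>
    simp [amat, planeRot, e, Complex.cos_mul_I, Complex.sin_mul_I] <;> ring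

/-- **Lemma `lem:a0-spin`.** For every `θ ∈ ℝ`, the matrices `ã_θ` and `a_{2θ/3}`
belong to `SO(8,ℂ)`, `a_{2θ/3}` fixes `e₀`, and `(a_{2θ/3} x)(ã_θ y) = ã_θ (xy)` for
all `x, y ∈ 𝕆_ℂ`.  In particular `ã_θ ∈ B₃(ℂ)`, so the abelian group
`Ã₀ = {ã_θ : θ ∈ ℝ}` is contained in `Spin(7,ℂ)`, and the triality homomorphism `π`
satisfies `π(ã_θ) = a_{2θ/3}`. -/
theorem stmt10 (θ : ℝ) :
    SO8 (atil θ) ∧ SO8 (amat (2 * θ / 3)) ∧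
    (amat (2 * θ / 3)).mulVec (e 0) = e 0 ∧
    (∀ x y, octMul ((amat (2 * θ / 3)).mulVec x) ((atil θ).mulVec y)
      = (atil θ).mulVec (octMul x y)) ∧
    inB3 (atil θ) := by
  have hx : ((2 * θ / 3 : ℝ) : ℂ) * Complex.I = 2 * (θ / 3 * Complex.I) := by
    push_cast; ring
  rw [amat_eq_planeRot, hx, atil_eq_planeRot]
  have hmul := octMul_planeRot (θ / 3 * Complex.I)
  have he := planeRot_mulVec_e_zero (2 * (θ / 3 * Complex.I))
  exact ⟨planeRot_SO8 _ _, planeRot_SO8 _ _, he, hmul,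
    planeRot_SO8 _ _, _, planeRot_SO8 _ _, he, hmul⟩
end
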